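/- For n ≥ 0, Ã_{2n+1}(t,-1) = (1+t) Ã_{2n}(t,-1) + t ∑_{k=1}^n C(n,k) A_{2k}(t,-1) Ã_{2n-2k}(t,-1), where A_m(t,q) = ∑_{π∈S_m} t^{exc(π)} q^{maj(π)-exc(π)} and Ã_m(t,q) = 1 + t ∑_{j=1}^m [m choose j]_q A_j(t,q). -/

import Mathlib

open Finset

/-- A permutation of `Fin n` viewed as a function `ℕ → ℕ` (0-based), identity outside. -/
def pf {n : ℕ} (π : Equiv.Perm (Fin n)) (i : ℕ) : ℕ :=
  if h : i < n then (π ⟨i, h⟩ : ℕ) else i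

/-- Number of descents. -/
def desN {n : ℕ} (π : Equiv.Perm (Fin n)) : ℕ :=
  ((range (n - 1)).filter (fun i => pf π (i + 1) < pf π i)).card

/-- Number of inversions. -/
def invN {n : ℕ} (π : Equiv.Perm (Fin n)) : ℕ :=
  (((range n) ×ˢ (range n)).filter (fun p => p.1 < p.2 ∧ pf π p.2 < pf π p.1)).card

/-- Number of excedances. -/
def excN {n : ℕ} (π : Equiv.Perm (Fin n)) : ℕ :=
  ((range n).filter (fun i => i < pf π i)).card

/-- Major index. -/
def majN {n : ℕ} (π : Equiv.Perm (Fin n)) : ℕ :=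
  ∑ i ∈ (range (n - 1)).filter (fun i => pf π (i + 1) < pf π i), (i + 1)

/-- Number of admissible inversions. -/
def aiN {n : ℕ} (π : Equiv.Perm (Fin n)) : ℕ :=
  (((range n) ×ˢ (range n)).filter (fun p => p.1 < p.2 ∧ pf π p.2 < pf π p.1 ∧
    ((0 < p.1 ∧ pf π (p.1 - 1) < pf π p.1) ∨ ∃ k < p.2, p.1 < k ∧ pf π p.1 < pf π k))).card

/-- The classical Eulerian polynomial `A_n(t) = ∑_{π ∈ S_n} t^{des π}`. -/
def eulerPoly (R : Type*) [CommRing R] (n : ℕ) (t : R) : R :=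
  ∑ π : Equiv.Perm (Fin n), t ^ desN π

/-- The (maj, exc) q-Eulerian polynomial `A_n(t,q)`. -/
def Aq (R : Type*) [CommRing R] (n : ℕ) (t q : R) : R :=
  ∑ π : Equiv.Perm (Fin n), t ^ excN π * q ^ (majN π - excN π)

/-- The Gaussian binomial coefficient (as a value at `q`), via the q-Pascal recurrence. -/
def gaussR {R : Type*} [CommRing R] (q : R) : ℕ → ℕ → R
  | _, 0 => 1
  | 0, _ + 1 => 0
  | n + 1, k + 1 => gaussR q n k + q ^ (k + 1) * gaussR q n (k + 1)

/-- The q-binomial-Eulerian polynomial `Ã_n(t,q)`. -/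
def Atilde (R : Type*) [CommRing R] (n : ℕ) (t q : R) : R :=
  1 + t * ∑ m ∈ Icc 1 n, gaussR q n m * Aq R m t q

/-- Membership in PRW: if the permutation has an ascent, then the first ascent
carries the smallest letter. -/
def isPRW {n : ℕ} (π : Equiv.Perm (Fin n)) : Prop :=
  ∀ i < n, i + 1 < n → pf π i < pf π (i + 1) →
    (∀ j < i, ¬ pf π j < pf π (j + 1)) → pf π i = 0

instance {n : ℕ} : DecidablePred (isPRW (n := n)) := fun _ => by
  unfold isPRW; infer_instance

/-- 1-based entries with boundary convention `σ₀ = σ_{n+1} = +∞` (encoded as `n`). -/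
def extv {n : ℕ} (π : Equiv.Perm (Fin n)) (i : ℕ) : ℕ :=
  if 1 ≤ i ∧ i ≤ n then pf π (i - 1) else n

/-- Number of non-initial double descents. -/
def ddN {n : ℕ} (π : Equiv.Perm (Fin n)) : ℕ :=
  ((Icc 2 n).filter (fun i => extv π (i + 1) < extv π i ∧ extv π i < extv π (i - 1))).card

lemma pf_lt {n : ℕ} (π : Equiv.Perm (Fin n)) {i : ℕ} (h : i < n) : pf π i < n := by
  simp [pf, h]

lemma pf_inj {n : ℕ} (π : Equiv.Perm (Fin n)) {i j : ℕ} (hi : i < n) (hj : j < n)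
    (h : pf π i = pf π j) : i = j := by
  simp only [pf, hi, hj, dif_pos] at h
  have := π.injective (Fin.ext h)
  simpa using this

lemma exists_des {n : ℕ} (π : Equiv.Perm (Fin n)) {i : ℕ} (hi : i < n) (h : i < pf π i) :
    ∃ d, i ≤ d ∧ d < n - 1 ∧ pf π (d + 1) < pf π d := by
  by_contra hc
  push Not at hc
  have key : ∀ k, i + k < n → pf π i + k ≤ pf π (i + k) := by
    intro k
    induction k with
    | zero => intro _; simp
    | succ k ih =>
      intro hk
      have h1 := ih (by omega)
      have h2 := hc (i + k) (by omega) (by omega)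
      have h3 : pf π (i + k) ≠ pf π (i + k + 1) := fun he => by
        have := pf_inj π (by omega) (by omega) he
        omega
      have : i + (k + 1) = i + k + 1 := by ring
      rw [this]; omega
  have h1 := key (n - 1 - i) (by omega)
  have h2 := pf_lt π (i := i + (n - 1 - i)) (by omega)
  omega

lemma exc_le_maj {n : ℕ} (π : Equiv.Perm (Fin n)) : excN π ≤ majN π := by
  unfold excN
  rcases ((range n).filter (fun i => i < pf π i)).eq_empty_or_nonempty with h0 | h0
  · simp [h0]
  · have hm := Finset.max'_mem _ h0
    set M := ((range n).filter (fun i => i < pf π i)).max' h0 with hM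
    obtain ⟨hm1, hm2⟩ := Finset.mem_filter.1 hm
    obtain ⟨d, hd1, hd2, hd3⟩ := exists_des π (Finset.mem_range.1 hm1) hm2
    have hsub : ((range n).filter (fun i => i < pf π i)) ⊆ range (d + 1) := by
      intro x hx
      have := Finset.le_max' _ x hx
      rw [Finset.mem_range]
      omega
    have hc := Finset.card_le_card hsub
    rw [Finset.card_range] at hc
    refine hc.trans ?_
    unfold majN
    exact Finset.single_le_sum (f := fun i => i + 1) (fun _ _ => Nat.zero_le _)
      (Finset.mem_filter.2 ⟨Finset.mem_range.2 hd2, hd3⟩)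

/-- weight of a block -/
def wt {R : Type*} [CommRing R] (t : R) (j a b : ℕ) : R :=
  (if b < a then -1 else 1) * ((if 2 * j < a then -t else 1) * (if 2 * j + 1 < b then -t else 1))

/-- symmetrised weight of a block -/
def wt' {R : Type*} [CommRing R] (t : R) (j a b : ℕ) : R :=
  if b = 2 * j + 1 then (1 + t) * (if 2 * j < a then t else 1) else 0

lemma wt_symm {R : Type*} [CommRing R] (t : R) (j a b : ℕ) (h : a ≠ b) :
    wt t j a b + wt t j b a = wt' t j a b + wt' t j b a := by
  unfold wt wt'
  split_ifs <;> first | omega | ring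

lemma prod_range_two_mul {R : Type*} [CommRing R] (f : ℕ → R) (n : ℕ) :
    ∏ i ∈ range (2 * n), f i = ∏ j ∈ range n, (f (2 * j) * f (2 * j + 1)) := by
  induction n with
  | zero => simp
  | succ n ih =>
    rw [Finset.prod_range_succ, ← ih, show 2 * (n + 1) = 2 * n + 1 + 1 by ring,
      Finset.prod_range_succ, Finset.prod_range_succ, mul_assoc]

lemma pow_exc {R : Type*} [CommRing R] (t : R) {m : ℕ} (π : Equiv.Perm (Fin m)) :
    t ^ excN π = ∏ i ∈ range m, (if i < pf π i then t else 1) := by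
  unfold excN
  rw [Finset.prod_ite]; simp

lemma pow_exc2 {R : Type*} [CommRing R] (t : R) {m : ℕ} (π : Equiv.Perm (Fin m)) :
    t ^ excN π = ∏ i ∈ range (2 * (m / 2)), (if i < pf π i then t else 1) := by
  rw [pow_exc]
  rcases Nat.even_or_odd' m with ⟨n, rfl | rfl⟩
  · congr 2; omega
  · rw [Finset.prod_range_succ, if_neg, mul_one]
    · congr 2; omega
    · have := pf_lt π (i := 2 * n) (by omega); omega

lemma sign_maj {R : Type*} [CommRing R] {m : ℕ} (π : Equiv.Perm (Fin m)) :
    (-1 : R) ^ majN π = ∏ j ∈ range (m / 2), (if pf π (2 * j + 1) < pf π (2 * j) then -1 else 1) := by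
  have h1 : (-1 : R) ^ majN π
      = ∏ i ∈ range (m - 1), (if pf π (i + 1) < pf π i then (-1 : R) ^ (i + 1) else 1) := by
    unfold majN
    rw [Finset.prod_ite, ← Finset.prod_pow_eq_pow_sum]; simp
  have h2 : ∏ i ∈ range (m - 1), (if pf π (i + 1) < pf π i then (-1 : R) ^ (i + 1) else 1)
      = ∏ i ∈ range (2 * (m / 2)), (if pf π (i + 1) < pf π i then (-1 : R) ^ (i + 1) else 1) := by
    rcases Nat.even_or_odd' m with ⟨n, rfl | rfl⟩
    · rcases n with _ | n
      · simp
      · rw [show 2 * (n + 1) - 1 = 2 * n + 1 by omega,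
          show 2 * (2 * (n + 1) / 2) = 2 * n + 1 + 1 by omega, Finset.prod_range_succ _ (2 * n + 1)]
        have : (-1 : R) ^ (2 * n + 1 + 1) = 1 := Even.neg_one_pow ⟨n + 1, by ring⟩
        rw [this]; simp
    · congr 2; omega
  rw [h1, h2, prod_range_two_mul]
  refine Finset.prod_congr rfl fun j _ => ?_
  have e1 : (-1 : R) ^ (2 * j + 1 + 1) = 1 := Even.neg_one_pow ⟨j + 1, by ring⟩
  have e2 : (-1 : R) ^ (2 * j + 1) = -1 := Odd.neg_one_pow ⟨j, by ring⟩
  rw [e1, e2]; simp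

lemma weight_eq {R : Type*} [CommRing R] (t : R) {m : ℕ} (π : Equiv.Perm (Fin m)) :
    t ^ excN π * (-1) ^ (majN π - excN π)
      = ∏ j ∈ range (m / 2), wt t j (pf π (2 * j)) (pf π (2 * j + 1)) := by
  have h : (-1 : R) ^ (majN π - excN π) = (-1) ^ majN π * (-1) ^ excN π := by
    conv_rhs => rw [← Nat.sub_add_cancel (exc_le_maj π), pow_add, mul_assoc, ← mul_pow]
    simp
  rw [h, mul_left_comm, ← mul_pow, mul_neg_one, sign_maj, pow_exc2, prod_range_two_mul,
    ← Finset.prod_mul_distrib]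
  rfl

lemma replace_one {R : Type*} [CommRing R] {m : ℕ} (u u' : ℕ → ℕ → ℕ → R) (j : ℕ)
    (hj : j < m / 2) (hne : ∀ i, i ≠ j → u i = u' i)
    (hs : ∀ a b, a ≠ b → u j a b + u j b a = u' j a b + u' j b a) :
    ∑ π : Equiv.Perm (Fin m), ∏ i ∈ range (m / 2), u i (pf π (2 * i)) (pf π (2 * i + 1))
      = ∑ π : Equiv.Perm (Fin m), ∏ i ∈ range (m / 2), u' i (pf π (2 * i)) (pf π (2 * i + 1)) := by
  rw [← sub_eq_zero, ← Finset.sum_sub_distrib]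
  have h0 : 2 * j < m := by omega
  have h1 : 2 * j + 1 < m := by omega
  set s : Equiv.Perm (Fin m) := Equiv.swap ⟨2 * j, h0⟩ ⟨2 * j + 1, h1⟩ with hsdef
  have hjm : j ∈ range (m / 2) := Finset.mem_range.2 hj
  have hfac : ∀ π : Equiv.Perm (Fin m),
      (∏ i ∈ range (m / 2), u i (pf π (2 * i)) (pf π (2 * i + 1)))
        - ∏ i ∈ range (m / 2), u' i (pf π (2 * i)) (pf π (2 * i + 1))
      = (u j (pf π (2 * j)) (pf π (2 * j + 1)) - u' j (pf π (2 * j)) (pf π (2 * j + 1)))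
        * ∏ i ∈ (range (m / 2)).erase j, u i (pf π (2 * i)) (pf π (2 * i + 1)) := by
    intro π
    rw [← Finset.mul_prod_erase _ _ hjm, ← Finset.mul_prod_erase _ (fun i => u' i _ _) hjm, sub_mul]
    congr 2
    refine Finset.prod_congr rfl fun i hi => ?_
    rw [hne i (Finset.ne_of_mem_erase hi)]
  simp_rw [hfac]
  have p0 : ∀ π : Equiv.Perm (Fin m), pf (π * s) (2 * j) = pf π (2 * j + 1) := by
    intro π; simp [pf, h0, h1, hsdef]
  have p1 : ∀ π : Equiv.Perm (Fin m), pf (π * s) (2 * j + 1) = pf π (2 * j) := by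
    intro π; simp [pf, h0, h1, hsdef]
  have p2 : ∀ (π : Equiv.Perm (Fin m)) (i : ℕ), i ≠ 2 * j → i ≠ 2 * j + 1 →
      pf (π * s) i = pf π i := by
    intro π i hi1 hi2
    unfold pf
    split_ifs with h
    · rw [Equiv.Perm.mul_apply, hsdef, Equiv.swap_apply_of_ne_of_ne] <;>
        simpa [Fin.ext_iff] using by assumption
    · rfl
  refine Finset.sum_involution (fun π _ => π * s) ?_ ?_ (fun _ _ => Finset.mem_univ _) ?_
  · intro π _
    have hr : ∏ i ∈ (range (m / 2)).erase j, u i (pf (π * s) (2 * i)) (pf (π * s) (2 * i + 1))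
        = ∏ i ∈ (range (m / 2)).erase j, u i (pf π (2 * i)) (pf π (2 * i + 1)) := by
      refine Finset.prod_congr rfl fun i hi => ?_
      have := Finset.ne_of_mem_erase hi
      rw [p2 π _ (by omega) (by omega), p2 π _ (by omega) (by omega)]
    rw [hr, p0, p1, ← add_mul]
    have hab : pf π (2 * j) ≠ pf π (2 * j + 1) := fun he => by
      have := pf_inj π h0 h1 he; omega
    have := hs _ _ hab
    rw [show ∀ a b c d : R, a - b + (c - d) = (a + c) - (b + d) by intros; ring, this, sub_self,
      zero_mul]
  · intro π _ _ he
    have : s = 1 := by simpa using he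
    have h2 := congrArg (fun f : Equiv.Perm (Fin m) => f ⟨2 * j, h0⟩) this
    simp [hsdef] at h2
  · intro π _
    rw [mul_assoc, hsdef, Equiv.swap_mul_self, mul_one]

lemma replace_all {R : Type*} [CommRing R] {m : ℕ} (v v' : ℕ → ℕ → ℕ → R)
    (hs : ∀ j a b, a ≠ b → v j a b + v j b a = v' j a b + v' j b a) :
    ∑ π : Equiv.Perm (Fin m), ∏ i ∈ range (m / 2), v i (pf π (2 * i)) (pf π (2 * i + 1))
      = ∑ π : Equiv.Perm (Fin m), ∏ i ∈ range (m / 2), v' i (pf π (2 * i)) (pf π (2 * i + 1)) := by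
  have key : ∀ k, k ≤ m / 2 →
      ∑ π : Equiv.Perm (Fin m), ∏ i ∈ range (m / 2), v i (pf π (2 * i)) (pf π (2 * i + 1))
      = ∑ π : Equiv.Perm (Fin m), ∏ i ∈ range (m / 2),
        (fun i => if i < k then v' i else v i) i (pf π (2 * i)) (pf π (2 * i + 1)) := by
    intro k
    induction k with
    | zero => intro _; simp
    | succ k ih =>
      intro hk
      rw [ih (by omega)]
      refine replace_one _ _ k (by omega) ?_ ?_
      · intro i hi
        have : i < k ↔ i < k + 1 := by omega
        simp [this]
      · intro a b hab
        simpa using hs k a b hab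
  rw [key (m / 2) le_rfl]
  refine Finset.sum_congr rfl fun π _ => Finset.prod_congr rfl fun i hi => ?_
  simp [Finset.mem_range.1 hi]

/-- Eulerian polynomial by excedances -/
def P (R : Type*) [CommRing R] (n : ℕ) (t : R) : R := ∑ σ : Equiv.Perm (Fin n), t ^ excN σ

/-- Even positions -/
def evenEquiv (m : ℕ) : Fin ((m + 1) / 2) ≃ {x : Fin m // (x : ℕ) % 2 = 0} where
  toFun i := ⟨⟨2 * i, by omega⟩, by simp⟩
  invFun x := ⟨(x.1 : ℕ) / 2, by have := x.1.2; have := x.2; omega⟩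
  left_inv i := by ext; simp
  right_inv x := by ext; have := x.2; simp; omega

lemma sum_wt' {R : Type*} [CommRing R] (t : R) (m : ℕ) :
    ∑ π : Equiv.Perm (Fin m), ∏ i ∈ range (m / 2), wt' t i (pf π (2 * i)) (pf π (2 * i + 1))
      = (1 + t) ^ (m / 2) * P R ((m + 1) / 2) t := by
  unfold P
  rw [Finset.mul_sum]
  symm
  refine Finset.sum_of_injOn (fun σ => σ.extendDomain (evenEquiv m)) ?_ (fun _ _ => Finset.mem_coe.2 (Finset.mem_univ _)) ?_ ?_
  · intro a _ b _ hab
    exact Equiv.Perm.extendDomainHom_injective (evenEquiv m) hab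
  · intro π _ hπ
    by_contra hne
    apply hπ
    have hfix : ∀ x : Fin m, ¬ ((x : ℕ) % 2 = 0) → π x = x := by
      intro x hx
      by_contra hx2
      apply hne
      refine Finset.prod_eq_zero (i := (x : ℕ) / 2) (Finset.mem_range.2 (by omega)) ?_
      have e : 2 * ((x : ℕ) / 2) + 1 = x := by omega
      unfold wt'
      rw [e, if_neg]
      simpa [pf, Fin.ext_iff] using hx2
    have hiff : ∀ x : Fin m, ((π x : Fin m) : ℕ) % 2 = 0 ↔ (x : ℕ) % 2 = 0 := by
      intro x
      constructor
      · intro h; by_contra h2; rw [hfix x h2] at h; exact h2 h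
      · intro h; by_contra h2
        have := π.injective (hfix _ h2)
        rw [this] at h2; exact h2 h
    refine ⟨(evenEquiv m).symm.permCongr (π.subtypePerm hiff), Finset.mem_coe.2 (Finset.mem_univ _), ?_⟩
    ext x
    by_cases hx : (x : ℕ) % 2 = 0
    · simp only
      rw [Equiv.Perm.extendDomain_apply_subtype (p := fun x : Fin m => (x : ℕ) % 2 = 0) _ _ hx]
      simp [Equiv.permCongr_apply]
    · simp only
      rw [Equiv.Perm.extendDomain_apply_not_subtype (p := fun x : Fin m => (x : ℕ) % 2 = 0) _ _ hx, hfix x hx]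
  · intro σ _
    have hodd : ∀ i ∈ range (m / 2), pf (σ.extendDomain (evenEquiv m)) (2 * i + 1) = 2 * i + 1 := by
      intro i hi
      have := Finset.mem_range.1 hi
      have h1 : 2 * i + 1 < m := by omega
      simp only [pf, h1, dif_pos]
      rw [Equiv.Perm.extendDomain_apply_not_subtype]
      simp
    have heven : ∀ i ∈ range (m / 2), pf (σ.extendDomain (evenEquiv m)) (2 * i) = 2 * pf σ i := by
      intro i hi
      have := Finset.mem_range.1 hi
      have h1 : 2 * i < m := by omega
      have h2 : i < (m + 1) / 2 := by omega
      simp only [pf, h1, h2, dif_pos]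
      have := Equiv.Perm.extendDomain_apply_image σ (evenEquiv m) ⟨i, h2⟩
      simpa [evenEquiv] using congrArg Fin.val this
    have hprod : t ^ excN σ = ∏ i ∈ range (m / 2), (if i < pf σ i then t else 1) := by
      rw [pow_exc]
      rcases Nat.even_or_odd' m with ⟨n, rfl | rfl⟩
      · congr 2; omega
      · have e1 : range ((2 * n + 1 + 1) / 2) = range (n + 1) := by congr 1; omega
        have e2 : range ((2 * n + 1) / 2) = range n := by congr 1; omega
        rw [e1, e2, Finset.prod_range_succ, if_neg, mul_one]
        have := pf_lt σ (i := n) (by omega)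
        omega
    rw [hprod, ← Finset.card_range (m / 2), ← Finset.prod_const, Finset.card_range,
      ← Finset.prod_mul_distrib]
    refine Finset.prod_congr rfl fun i hi => ?_
    rw [hodd i hi, heven i hi]
    simp [wt']

lemma Aq_eq {R : Type*} [CommRing R] (t : R) (m : ℕ) :
    Aq R m t (-1) = (1 + t) ^ (m / 2) * P R ((m + 1) / 2) t := by
  unfold Aq
  simp_rw [weight_eq]
  rw [replace_all (wt t) (wt' t) (fun j a b h => wt_symm t j a b h), sum_wt']

lemma excN_eq_sum {n : ℕ} (π : Equiv.Perm (Fin n)) :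
    excN π = ∑ i : Fin n, if i < π i then 1 else 0 := by
  unfold excN
  rw [Finset.card_filter, Finset.sum_range]
  refine Finset.sum_congr rfl fun i _ => ?_
  simp only [pf, Fin.is_lt, dif_pos, Fin.eta, Fin.lt_def]

lemma exc_ins_zero {n : ℕ} (e : Equiv.Perm (Fin n)) :
    excN (Equiv.Perm.decomposeFin.symm (0, e)) = excN e := by
  rw [excN_eq_sum, excN_eq_sum, Fin.sum_univ_succ]
  simp

lemma exc_ins_succ {n : ℕ} (e : Equiv.Perm (Fin n)) (x : Fin n) :
    excN (Equiv.Perm.decomposeFin.symm ((e x).succ, e)) + (if x < e x then 1 else 0)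
      = excN e + 1 := by
  rw [excN_eq_sum, excN_eq_sum, Fin.sum_univ_succ]
  have h : ∀ k : Fin n, (if k.succ < Equiv.Perm.decomposeFin.symm ((e x).succ, e) k.succ
      then 1 else 0) + (if k = x then (if x < e x then 1 else 0) else 0)
      = (if k < e k then 1 else 0) := by
    intro k
    rw [Equiv.Perm.decomposeFin_symm_apply_succ]
    by_cases hk : k = x
    · subst hk; simp
    · rw [Equiv.swap_apply_of_ne_of_ne (Fin.succ_ne_zero _)]
      · simp [hk]
      · simpa using hk
  rw [← Finset.sum_congr rfl (fun k _ => h k), Finset.sum_add_distrib]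
  simp
  ring

open Polynomial in
lemma P_succ (n : ℕ) : P ℤ[X] (n + 1) X
    = (1 + (n : ℤ[X]) * X) * P ℤ[X] n X + X * (1 - X) * derivative (P ℤ[X] n X) := by
  have key : ∀ e : Equiv.Perm (Fin n),
      ∑ p : Fin (n + 1), (X : ℤ[X]) ^ excN (Equiv.Perm.decomposeFin.symm (p, e))
      = (1 + (n : ℤ[X]) * X) * X ^ excN e + X * (1 - X) * derivative (X ^ excN e) := by
    intro e
    rw [Fin.sum_univ_succ, exc_ins_zero,
      ← Equiv.sum_comp e (fun y => (X : ℤ[X]) ^ excN (Equiv.Perm.decomposeFin.symm (y.succ, e)))]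
    have h1 : ∀ x : Fin n, (X : ℤ[X]) ^ excN (Equiv.Perm.decomposeFin.symm ((e x).succ, e))
        = X ^ excN e * X + ((if x < e x then 1 else 0 : ℕ) : ℤ[X]) * (X ^ excN e * (1 - X)) := by
      intro x
      have := exc_ins_succ e x
      split_ifs at this ⊢ with hx
      · rw [Nat.add_right_cancel this]; push_cast; ring
      · rw [add_zero] at this
        rw [this]; push_cast; ring
    rw [Finset.sum_congr rfl (fun x _ => h1 x), Finset.sum_add_distrib, ← Finset.sum_mul,
      ← Finset.sum_mul,
      ← Nat.cast_sum, ← excN_eq_sum, Finset.sum_const, Finset.card_univ, Fintype.card_fin,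
      nsmul_eq_mul, derivative_X_pow]
    rcases excN e with _ | k
    · simp <;> ring
    · simp <;> ring
  unfold P
  rw [← Equiv.sum_comp Equiv.Perm.decomposeFin.symm, Fintype.sum_prod_type, Finset.sum_comm,
    Finset.sum_congr rfl (fun e _ => key e), Finset.sum_add_distrib, derivative_sum,
    Finset.mul_sum, Finset.mul_sum]

lemma P_zero (R : Type*) [CommRing R] (t : R) : P R 0 t = 1 := by
  simp [P, excN]

/-- binomial self-convolution -/
def conv {R : Type*} [CommRing R] (a : ℕ → R) (n : ℕ) : R :=
  ∑ k ∈ range (n + 1), (n.choose k : R) * (a k * a (n - k))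

open Polynomial in
lemma conv_succ (n : ℕ) : conv (fun k => P ℤ[X] k X) (n + 1)
    = (2 + (n : ℤ[X]) * X) * conv (fun k => P ℤ[X] k X) n
      + X * (1 - X) * derivative (conv (fun k => P ℤ[X] k X) n) := by
  unfold conv
  rw [Finset.sum_choose_succ_mul (fun i j => P ℤ[X] i X * P ℤ[X] j X) n, derivative_sum,
    Finset.mul_sum, Finset.mul_sum, ← Finset.sum_add_distrib, ← Finset.sum_add_distrib]
  refine Finset.sum_congr rfl fun k hk => ?_
  have hk' : k ≤ n := by have := Finset.mem_range.1 hk; omega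
  obtain ⟨l, rfl⟩ := Nat.exists_eq_add_of_le hk'
  have e1 : k + l + 1 - k = l + 1 := by omega
  have e2 : k + l - k = l := by omega
  rw [e1, e2, P_succ, P_succ, derivative_mul, derivative_mul, derivative_natCast]
  push_cast
  ring

open Polynomial in
lemma P_quad_poly (n : ℕ) : P ℤ[X] (n + 1) X
    = (1 - X) * P ℤ[X] n X + X * conv (fun k => P ℤ[X] k X) n := by
  induction n with
  | zero => rw [P_succ, conv]; simp [P_zero]
  | succ n ih =>
    conv_rhs => rw [conv_succ, P_succ n]
    conv_lhs => rw [P_succ, ih]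
    simp only [derivative_add, derivative_mul, derivative_sub, derivative_one, derivative_X]
    push_cast
    ring

open Polynomial in
lemma P_quad {R : Type*} [CommRing R] (t : R) (n : ℕ) : P R (n + 1) t
    = (1 - t) * P R n t + t * conv (fun k => P R k t) n := by
  have h := congrArg (eval₂ (Int.castRingHom R) t) (P_quad_poly n)
  have hP : ∀ k, eval₂ (Int.castRingHom R) t (P ℤ[X] k X) = P R k t := by
    intro k; simp [P, eval₂_finsetSum]
  simp only [conv, eval₂_add, eval₂_mul, eval₂_sub, eval₂_finsetSum, hP, eval₂_X, eval₂_one,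
    eval₂_natCast] at h
  exact h

lemma A_quad {R : Type*} [CommRing R] (t : R) (n : ℕ) : Aq R (2 * n + 1) t (-1)
    = (1 - t) * Aq R (2 * n) t (-1) + t * conv (fun k => Aq R (2 * k) t (-1)) n := by
  have h : ∀ k, Aq R (2 * k) t (-1) = (1 + t) ^ k * P R k t := by
    intro k; rw [Aq_eq, show 2 * k / 2 = k by omega, show (2 * k + 1) / 2 = k by omega]
  have hc : conv (fun k => Aq R (2 * k) t (-1)) n = (1 + t) ^ n * conv (fun k => P R k t) n := by
    unfold conv
    rw [Finset.mul_sum]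
    refine Finset.sum_congr rfl fun k hk => ?_
    obtain ⟨l, rfl⟩ := Nat.exists_eq_add_of_le (show k ≤ n by have := Finset.mem_range.1 hk; omega)
    simp only [h]
    rw [pow_add, show k + l - k = l by omega]
    ring
  rw [hc, h, Aq_eq, show (2 * n + 1) / 2 = n by omega, show (2 * n + 1 + 1) / 2 = n + 1 by omega,
    P_quad]
  ring

lemma gauss_neg_one {R : Type*} [CommRing R] (n : ℕ) :
    (∀ k, gaussR (-1 : R) (2 * n) (2 * k) = (n.choose k : R)) ∧
    (∀ k, gaussR (-1 : R) (2 * n) (2 * k + 1) = 0) ∧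
    (∀ k, gaussR (-1 : R) (2 * n + 1) (2 * k) = (n.choose k : R)) ∧
    (∀ k, gaussR (-1 : R) (2 * n + 1) (2 * k + 1) = (n.choose k : R)) := by
  have e1 : ∀ k : ℕ, (-1 : R) ^ (2 * k + 1 + 1) = 1 := fun k => Even.neg_one_pow ⟨k + 1, by ring⟩
  have e2 : ∀ k : ℕ, (-1 : R) ^ (2 * k + 1) = -1 := fun k => Odd.neg_one_pow ⟨k, by ring⟩
  have z : ∀ n, gaussR (-1 : R) n 0 = 1 := by intro n; cases n <;> simp [gaussR]
  have odd_of_even : ∀ n, (∀ k, gaussR (-1 : R) (2 * n) (2 * k) = (n.choose k : R)) →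
      (∀ k, gaussR (-1 : R) (2 * n) (2 * k + 1) = 0) →
      (∀ k, gaussR (-1 : R) (2 * n + 1) (2 * k) = (n.choose k : R)) ∧
      (∀ k, gaussR (-1 : R) (2 * n + 1) (2 * k + 1) = (n.choose k : R)) := by
    intro n h1 h2
    constructor
    · intro k
      rcases k with _ | k
      · simp [z]
      · have := h1 (k + 1)
        rw [show 2 * (k + 1) = 2 * k + 1 + 1 by ring] at this ⊢
        rw [gaussR, h2, this, e1]; ring
    · intro k
      rw [gaussR, h1, h2]; ring
  induction n with
  | zero =>
    have h1 : ∀ k, gaussR (-1 : R) (2 * 0) (2 * k) = (Nat.choose 0 k : R) := by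
      intro k
      rcases k with _ | k
      · simp [z]
      · rw [show 2 * (k + 1) = 2 * k + 1 + 1 by ring]; simp [gaussR]
    have h2 : ∀ k, gaussR (-1 : R) (2 * 0) (2 * k + 1) = 0 := by intro k; simp [gaussR]
    exact ⟨h1, h2, odd_of_even 0 h1 h2⟩
  | succ n ih =>
    obtain ⟨-, -, h3, h4⟩ := ih
    have g1 : ∀ k, gaussR (-1 : R) (2 * (n + 1)) (2 * k) = ((n + 1).choose k : R) := by
      intro k
      rcases k with _ | k
      · simp [z]
      · have := h3 (k + 1)
        rw [show 2 * (k + 1) = 2 * k + 1 + 1 by ring] at this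
        rw [show 2 * (k + 1) = 2 * k + 1 + 1 by ring, show 2 * (n + 1) = 2 * n + 1 + 1 by ring,
          gaussR, h4, this, e1, Nat.choose_succ_succ]
        push_cast; ring
    have g2 : ∀ k, gaussR (-1 : R) (2 * (n + 1)) (2 * k + 1) = 0 := by
      intro k
      rw [show 2 * (n + 1) = 2 * n + 1 + 1 by ring, gaussR, h3, h4, e2]; ring
    exact ⟨g1, g2, odd_of_even _ g1 g2⟩

lemma sum_range_two_mul' {R : Type*} [CommRing R] (f : ℕ → R) (n : ℕ) :
    ∑ i ∈ range (2 * n), f i = ∑ j ∈ range n, (f (2 * j) + f (2 * j + 1)) := by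
  induction n with
  | zero => simp
  | succ n ih =>
    rw [Finset.sum_range_succ, ← ih, show 2 * (n + 1) = 2 * n + 1 + 1 by ring,
      Finset.sum_range_succ, Finset.sum_range_succ, add_assoc]

lemma sum_Icc_one {R : Type*} [CommRing R] (f : ℕ → R) (n : ℕ) :
    ∑ i ∈ Icc 1 n, f i = ∑ i ∈ range (n + 1), f i - f 0 := by
  rw [Finset.sum_range_succ', add_sub_cancel_right, Finset.range_eq_Ico,
    Finset.sum_Ico_add' f 0 n 1]
  rfl

lemma Aq_zero {R : Type*} [CommRing R] (t : R) : Aq R 0 t (-1) = 1 := by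
  rw [Aq_eq]; simp [P_zero]

lemma Atilde_even {R : Type*} [CommRing R] (t : R) (n : ℕ) : Atilde R (2 * n) t (-1)
    = 1 - t + t * ∑ k ∈ range (n + 1), (n.choose k : R) * Aq R (2 * k) t (-1) := by
  obtain ⟨h1, h2, -, -⟩ := gauss_neg_one (R := R) n
  have h0 := h1 0
  unfold Atilde
  rw [sum_Icc_one, Finset.sum_range_succ, sum_range_two_mul', Finset.sum_range_succ _ n]
  simp only [mul_zero] at h0
  simp only [h1, h2, h0, Aq_zero]
  simp
  ring

lemma Atilde_odd {R : Type*} [CommRing R] (t : R) (n : ℕ) : Atilde R (2 * n + 1) t (-1)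
    = Atilde R (2 * n) t (-1)
      + t * ∑ k ∈ range (n + 1), (n.choose k : R) * Aq R (2 * k + 1) t (-1) := by
  obtain ⟨-, -, h1, h2⟩ := gauss_neg_one (R := R) n
  have h0 := h1 0
  rw [Atilde_even]
  unfold Atilde
  rw [sum_Icc_one, show 2 * n + 1 + 1 = 2 * (n + 1) by ring, sum_range_two_mul']
  simp only [mul_zero] at h0
  simp only [h1, h2, h0, Aq_zero, Finset.sum_add_distrib]
  simp
  ring

lemma conv_assoc {R : Type*} [CommRing R] (a : ℕ → R) (n : ℕ) :
    ∑ k ∈ range (n + 1), (n.choose k : R) * conv a k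
      = ∑ j ∈ range (n + 1), (n.choose j : R) * a j *
          ∑ l ∈ range (n - j + 1), ((n - j).choose l : R) * a l := by
  unfold conv
  simp_rw [Finset.mul_sum]
  rw [Finset.sum_sigma', Finset.sum_sigma']
  refine Finset.sum_nbij' (fun x => ⟨x.2, x.1 - x.2⟩) (fun x => ⟨x.1 + x.2, x.1⟩) ?_ ?_ ?_ ?_ ?_
  · rintro ⟨k, j⟩ h
    simp only [Finset.mem_sigma, Finset.mem_range] at h ⊢
    omega
  · rintro ⟨k, j⟩ h
    simp only [Finset.mem_sigma, Finset.mem_range] at h ⊢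
    omega
  · rintro ⟨k, j⟩ h
    simp only [Finset.mem_sigma, Finset.mem_range] at h
    have : j + (k - j) = k := by omega
    simp [this]
  · rintro ⟨k, j⟩ h
    simp
  · rintro ⟨k, j⟩ h
    simp only [Finset.mem_sigma, Finset.mem_range] at h
    have := congrArg (Nat.cast : ℕ → R) (Nat.choose_mul (n := n) (k := k) (s := j) (by omega))
    push_cast at this
    simp only
    linear_combination (a j * a (k - j)) * this

/-- the recurrence for the odd-indexed signed q-binomial-Eulerian
polynomials at q = -1. -/
theorem stmt16 {R : Type*} [CommRing R] (t : R) (n : ℕ) :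
    Atilde R (2 * n + 1) t (-1) =
      (1 + t) * Atilde R (2 * n) t (-1) +
        t * ∑ k ∈ Icc 1 n, (n.choose k : R) * Aq R (2 * k) t (-1) *
          Atilde R (2 * n - 2 * k) t (-1) := by
  have hT : ∀ k ∈ range (n + 1), (n.choose k : R) * Aq R (2 * k) t (-1) *
      Atilde R (2 * n - 2 * k) t (-1)
      = (1 - t) * ((n.choose k : R) * Aq R (2 * k) t (-1))
        + t * ((n.choose k : R) * Aq R (2 * k) t (-1) *
          ∑ l ∈ range (n - k + 1), ((n - k).choose l : R) * Aq R (2 * l) t (-1)) := by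
    intro k _
    rw [← Nat.mul_sub, Atilde_even]
    ring
  have hO : ∀ k ∈ range (n + 1), (n.choose k : R) * Aq R (2 * k + 1) t (-1)
      = (1 - t) * ((n.choose k : R) * Aq R (2 * k) t (-1))
        + t * ((n.choose k : R) * conv (fun k => Aq R (2 * k) t (-1)) k) := by
    intro k _
    rw [A_quad]
    ring
  rw [Atilde_odd, sum_Icc_one, Finset.sum_congr rfl hT, Finset.sum_congr rfl hO,
    Finset.sum_add_distrib, Finset.sum_add_distrib, ← Finset.mul_sum, ← Finset.mul_sum,
    ← Finset.mul_sum, conv_assoc]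
  simp only [mul_zero, Aq_zero, Nat.choose_zero_right, Nat.cast_one, Nat.sub_zero]
  ring
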